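/- Let U ⊆ ℝ^d be open and let p = (n₁, n₂, n₃) : U → (ℝ³)³ be twice continuously differentiable with p(x) an orthonormal frame for every x ∈ U. For k = 1,…,6 let W_k(x) denote the 3×3 matrix field obtained from the matrices W_k associated with the frame p(x), let Δp(x) be the 3×3 matrix with rows Δn₁(x), Δn₂(x), Δn₃(x) (componentwise Laplacian), and let ∂_j p(x) be the matrix with rows ∂_j n₁(x), ∂_j n₂(x), ∂_j n₃(x). Then for every x ∈ U and every k ∈ {1,…,6}: W_k(x) · Δp(x) = − Σ_{j=1}^{d} (∂_j p(x)) · (∂_j W_k(x)), where · is the Frobenius inner product. -/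

import Mathlib

open Matrix

noncomputable section

/-- Vectors of `ℝ³`. -/
abbrev V3 : Type := Fin 3 → ℝ

/-- Frobenius inner product of `3 × 3` real matrices. -/
def frob (A B : Matrix (Fin 3) (Fin 3) ℝ) : ℝ := ∑ i, ∑ j, A i j * B i j

/-- The `3 × 3` matrix whose rows are the three given vectors. -/
def rowsOf (a b c : V3) : Matrix (Fin 3) (Fin 3) ℝ := Matrix.of ![a, b, c]

/-- `(n₁, n₂, n₃)` is an orthonormal frame of `ℝ³`. -/
def IsOrthoFrame (n₁ n₂ n₃ : V3) : Prop :=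
  n₁ ⬝ᵥ n₁ = 1 ∧ n₂ ⬝ᵥ n₂ = 1 ∧ n₃ ⬝ᵥ n₃ = 1 ∧
  n₁ ⬝ᵥ n₂ = 0 ∧ n₁ ⬝ᵥ n₃ = 0 ∧ n₂ ⬝ᵥ n₃ = 0

/-- The matrices `W₁, …, W₆` associated with a frame. -/
def Wmat (n₁ n₂ n₃ : V3) : Fin 6 → Matrix (Fin 3) (Fin 3) ℝ :=
  ![rowsOf 0 n₃ n₂, rowsOf n₃ 0 n₁, rowsOf n₂ n₁ 0,
    rowsOf n₁ 0 0, rowsOf 0 n₂ 0, rowsOf 0 0 n₃]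

/-- The partial derivative `∂ⱼ f` at `x` of a scalar function on `ℝ^d`. -/
def pd {d : ℕ} (j : Fin d) (f : (Fin d → ℝ) → ℝ) (x : Fin d → ℝ) : ℝ :=
  fderiv ℝ f x (Pi.single j 1)

/-- The `j`-th partial derivative of an `ℝ³`-valued map, taken componentwise. -/
def pvec {d : ℕ} (j : Fin d) (F : (Fin d → ℝ) → V3) (x : Fin d → ℝ) : V3 :=
  fun i => pd j (fun y => F y i) x

/-- The componentwise Laplacian `Δ F = Σⱼ ∂ⱼ∂ⱼ F` of an `ℝ³`-valued map. -/
def vlap {d : ℕ} (F : (Fin d → ℝ) → V3) (x : Fin d → ℝ) : V3 :=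
  fun i => ∑ j, pd j (pd j (fun y => F y i)) x

/-- The `j`-th partial derivative of a matrix-valued map, taken entrywise. -/
def pmat {d : ℕ} (j : Fin d) (F : (Fin d → ℝ) → Matrix (Fin 3) (Fin 3) ℝ)
    (x : Fin d → ℝ) : Matrix (Fin 3) (Fin 3) ℝ :=
  Matrix.of fun a b => pd j (fun y => F y a b) x

theorem pd_mul {d : ℕ} (j : Fin d) {f g : (Fin d → ℝ) → ℝ} {x : Fin d → ℝ}
    (hf : DifferentiableAt ℝ f x) (hg : DifferentiableAt ℝ g x) :
    pd j (fun y => f y * g y) x = f x * pd j g x + g x * pd j f x := by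
  unfold pd
  rw [fderiv_fun_mul hf hg]
  simp

theorem pd_add {d : ℕ} (j : Fin d) {f g : (Fin d → ℝ) → ℝ} {x : Fin d → ℝ}
    (hf : DifferentiableAt ℝ f x) (hg : DifferentiableAt ℝ g x) :
    pd j (fun y => f y + g y) x = pd j f x + pd j g x := by
  unfold pd
  rw [fderiv_fun_add hf hg]
  simp

theorem pd_congr {d : ℕ} (j : Fin d) {U : Set (Fin d → ℝ)} (hU : IsOpen U)
    {f g : (Fin d → ℝ) → ℝ} (h : ∀ y ∈ U, f y = g y) : ∀ x ∈ U, pd j f x = pd j g x := by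
  intro x hx
  unfold pd
  have : f =ᶠ[nhds x] g := Filter.eventuallyEq_of_mem (hU.mem_nhds hx) h
  rw [this.fderiv_eq]

theorem pd_const' {d : ℕ} (j : Fin d) (c : ℝ) (x : Fin d → ℝ) :
    pd j (fun _ => c) x = 0 := by
  simp [pd]

theorem diff_pd {d : ℕ} (j : Fin d) {U : Set (Fin d → ℝ)} (hU : IsOpen U)
    {f : (Fin d → ℝ) → ℝ} (hf : ContDiffOn ℝ 2 f U) {x : Fin d → ℝ} (hx : x ∈ U) :
    DifferentiableAt ℝ (pd j f) x := by
  have h1 : ContDiffOn ℝ 1 (fderiv ℝ f) U := hf.fderiv_of_isOpen hU (by norm_num)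
  have h2 : DifferentiableAt ℝ (fderiv ℝ f) x :=
    (h1.contDiffAt (hU.mem_nhds hx)).differentiableAt (by norm_num)
  unfold pd
  exact h2.clm_apply (differentiableAt_const _)

theorem pd_pd_mul {d : ℕ} (j : Fin d) {U : Set (Fin d → ℝ)} (hU : IsOpen U)
    {f g : (Fin d → ℝ) → ℝ} (hf : ContDiffOn ℝ 2 f U) (hg : ContDiffOn ℝ 2 g U)
    {x : Fin d → ℝ} (hx : x ∈ U) :
    pd j (pd j (fun y => f y * g y)) x
      = f x * pd j (pd j g) x + g x * pd j (pd j f) x + 2 * (pd j f x * pd j g x) := by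
  have D : ∀ {h : (Fin d → ℝ) → ℝ}, ContDiffOn ℝ 2 h U → ∀ y ∈ U, DifferentiableAt ℝ h y :=
    fun hh y hy => (hh.contDiffAt (hU.mem_nhds hy)).differentiableAt (by norm_num)
  rw [pd_congr j hU (fun y hy => pd_mul j (D hf y hy) (D hg y hy)) x hx,
    pd_add j ((D hf x hx).fun_mul (diff_pd j hU hg hx)) ((D hg x hx).fun_mul (diff_pd j hU hf hx)),
    pd_mul j (D hf x hx) (diff_pd j hU hg hx), pd_mul j (D hg x hx) (diff_pd j hU hf hx)]
  ring

theorem pd_pd_add {d : ℕ} (j : Fin d) {U : Set (Fin d → ℝ)} (hU : IsOpen U)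
    {f g : (Fin d → ℝ) → ℝ} (hf : ContDiffOn ℝ 2 f U) (hg : ContDiffOn ℝ 2 g U)
    {x : Fin d → ℝ} (hx : x ∈ U) :
    pd j (pd j (fun y => f y + g y)) x = pd j (pd j f) x + pd j (pd j g) x := by
  have D : ∀ {h : (Fin d → ℝ) → ℝ}, ContDiffOn ℝ 2 h U → ∀ y ∈ U, DifferentiableAt ℝ h y :=
    fun hh y hy => (hh.contDiffAt (hU.mem_nhds hy)).differentiableAt (by norm_num)
  rw [pd_congr j hU (fun y hy => pd_add j (D hf y hy) (D hg y hy)) x hx,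
    pd_add j (diff_pd j hU hf hx) (diff_pd j hU hg hx)]

/-- Twice differentiating the relation `F · G = c`, then summing over directions. -/
theorem lap_dot {d : ℕ} {U : Set (Fin d → ℝ)} (hU : IsOpen U)
    {F G : (Fin d → ℝ) → V3} (hF : ContDiffOn ℝ 2 F U) (hG : ContDiffOn ℝ 2 G U)
    {c : ℝ} (h : ∀ y ∈ U, F y ⬝ᵥ G y = c) {x : Fin d → ℝ} (hx : x ∈ U) :
    F x ⬝ᵥ vlap G x + G x ⬝ᵥ vlap F x = - ∑ j, 2 * (pvec j F x ⬝ᵥ pvec j G x) := by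
  have cF : ∀ i, ContDiffOn ℝ 2 (fun y => F y i) U := fun i => contDiffOn_pi.1 hF i
  have cG : ∀ i, ContDiffOn ℝ 2 (fun y => G y i) U := fun i => contDiffOn_pi.1 hG i
  have key : ∀ j : Fin d, ∑ i, (F x i * pd j (pd j (fun y => G y i)) x
      + G x i * pd j (pd j (fun y => F y i)) x) = - (2 * (pvec j F x ⬝ᵥ pvec j G x)) := by
    intro j
    have e : ∀ y ∈ U, F y 0 * G y 0 + F y 1 * G y 1 + F y 2 * G y 2 = c := by
      intro y hy
      rw [← h y hy]
      simp [dotProduct, Fin.sum_univ_three]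
    have z := pd_congr j hU (pd_congr j hU e) x hx
    have z0 : pd j (pd j (fun _ : Fin d → ℝ => c)) x = 0 := by
      have : pd j (fun _ : Fin d → ℝ => c) = fun _ => 0 := funext (pd_const' j c)
      rw [this, pd_const']
    rw [z0, pd_pd_add j hU (((cF 0).mul (cG 0)).add ((cF 1).mul (cG 1))) ((cF 2).mul (cG 2)) hx,
      pd_pd_add j hU ((cF 0).mul (cG 0)) ((cF 1).mul (cG 1)) hx,
      pd_pd_mul j hU (cF 0) (cG 0) hx, pd_pd_mul j hU (cF 1) (cG 1) hx,
      pd_pd_mul j hU (cF 2) (cG 2) hx] at z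
    simp only [dotProduct, Fin.sum_univ_three, pvec]
    linarith
  rw [← Finset.sum_neg_distrib, ← Finset.sum_congr rfl (fun j _ => key j), Finset.sum_comm]
  simp only [dotProduct, vlap, Finset.mul_sum, Finset.sum_add_distrib]

theorem statement11 {d : ℕ} (U : Set (Fin d → ℝ)) (hU : IsOpen U)
    (n : Fin 3 → (Fin d → ℝ) → V3)
    (hsm : ∀ i : Fin 3, ContDiffOn ℝ 2 (n i) U)
    (hframe : ∀ x ∈ U, IsOrthoFrame (n 0 x) (n 1 x) (n 2 x)) :
    ∀ x ∈ U, ∀ k : Fin 6,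
      frob (Wmat (n 0 x) (n 1 x) (n 2 x) k)
           (rowsOf (vlap (n 0) x) (vlap (n 1) x) (vlap (n 2) x))
      = -∑ j : Fin d,
          frob (rowsOf (pvec j (n 0) x) (pvec j (n 1) x) (pvec j (n 2) x))
               (pmat j (fun y => Wmat (n 0 y) (n 1 y) (n 2 y) k) x) := by
  intro x hx k
  have L := fun (a b : Fin 3) (c : ℝ) (h : ∀ y ∈ U, n a y ⬝ᵥ n b y = c) =>
    lap_dot hU (hsm a) (hsm b) h hx
  have h00 := L 0 0 1 fun y hy => (hframe y hy).1
  have h11 := L 1 1 1 fun y hy => (hframe y hy).2.1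
  have h22 := L 2 2 1 fun y hy => (hframe y hy).2.2.1
  have h01 := L 0 1 0 fun y hy => (hframe y hy).2.2.2.1
  have h02 := L 0 2 0 fun y hy => (hframe y hy).2.2.2.2.1
  have h12 := L 1 2 0 fun y hy => (hframe y hy).2.2.2.2.2
  have fr : ∀ a b c a' b' c' : V3, frob (rowsOf a b c) (rowsOf a' b' c')
      = a ⬝ᵥ a' + b ⬝ᵥ b' + c ⬝ᵥ c' := by
    intro a b c a' b' c'
    simp [frob, rowsOf, dotProduct, Fin.sum_univ_three]
  have pm : ∀ (j : Fin d) (A B C : (Fin d → ℝ) → V3),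
      pmat j (fun y => rowsOf (A y) (B y) (C y)) x
        = rowsOf (pvec j A x) (pvec j B x) (pvec j C x) := by
    intro j A B C
    ext a b
    fin_cases a <;> rfl
  have pz : ∀ j : Fin d, pvec j (fun _ => (0 : V3)) x = 0 := by
    intro j
    ext i
    exact pd_const' j 0 x
  have et : ∀ i, (fun y => n i y) = n i := fun i => rfl
  simp only [← Finset.mul_sum] at h00 h11 h22 h01 h02 h12
  have comm : ∀ a b : Fin 3, ∑ j, pvec j (n a) x ⬝ᵥ pvec j (n b) x
      = ∑ j, pvec j (n b) x ⬝ᵥ pvec j (n a) x :=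
    fun a b => Finset.sum_congr rfl fun j _ => dotProduct_comm _ _
  have c01 := comm 0 1
  have c02 := comm 0 2
  have c12 := comm 1 2
  fin_cases k
  · change frob (rowsOf 0 (n 2 x) (n 1 x)) _
      = -∑ j, frob _ (pmat j (fun y => rowsOf ((fun _ => 0) y) (n 2 y) (n 1 y)) x)
    simp only [fr, pm, pz, zero_dotProduct, dotProduct_zero, Finset.sum_add_distrib,
      Finset.sum_const_zero]
    linarith
  · change frob (rowsOf (n 2 x) 0 (n 0 x)) _
      = -∑ j, frob _ (pmat j (fun y => rowsOf (n 2 y) ((fun _ => 0) y) (n 0 y)) x)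
    simp only [fr, pm, pz, zero_dotProduct, dotProduct_zero, Finset.sum_add_distrib,
      Finset.sum_const_zero]
    linarith
  · change frob (rowsOf (n 1 x) (n 0 x) 0) _
      = -∑ j, frob _ (pmat j (fun y => rowsOf (n 1 y) (n 0 y) ((fun _ => 0) y)) x)
    simp only [fr, pm, pz, zero_dotProduct, dotProduct_zero, Finset.sum_add_distrib,
      Finset.sum_const_zero]
    linarith
  · change frob (rowsOf (n 0 x) 0 0) _
      = -∑ j, frob _ (pmat j (fun y => rowsOf (n 0 y) ((fun _ => 0) y) ((fun _ => 0) y)) x)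
    simp only [fr, pm, pz, zero_dotProduct, dotProduct_zero, Finset.sum_add_distrib,
      Finset.sum_const_zero]
    linarith
  · change frob (rowsOf 0 (n 1 x) 0) _
      = -∑ j, frob _ (pmat j (fun y => rowsOf ((fun _ => 0) y) (n 1 y) ((fun _ => 0) y)) x)
    simp only [fr, pm, pz, zero_dotProduct, dotProduct_zero, Finset.sum_add_distrib,
      Finset.sum_const_zero]
    linarith
  · change frob (rowsOf 0 0 (n 2 x)) _
      = -∑ j, frob _ (pmat j (fun y => rowsOf ((fun _ => 0) y) ((fun _ => 0) y) (n 2 y)) x)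
    simp only [fr, pm, pz, zero_dotProduct, dotProduct_zero, Finset.sum_add_distrib,
      Finset.sum_const_zero]
    linarith
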